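/- arXiv:hep-th/0611012 — 2 statements merged into one kernel-verified Lean document; each statement's English description precedes it below -/
import Mathlib

section
/- Functional relations of the 'Jost function' φ: for every θ ∈ ℂ for which all factors occurring below are defined (no Gamma argument is a pole and no denominator vanishes), one has (i) φ(θ) = φ(−θ)·a(−θ); (ii) φ(θ) = φ((N−1)·iη − θ); (iii) −b(θ)·φ(θ) = φ(2πi − θ); (iv) −b(θ)·φ(θ) = a(θ − 2πi)·φ(θ − 2πi). -/
open Complex

noncomputable section

/-- η = 2π/N, as a complex number. -/
def etaC (N : ℕ) : ℂ := 2 * (Real.pi : ℂ) / N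

/-- 2πi. -/
def twoPiI : ℂ := 2 * (Real.pi : ℂ) * Complex.I

/-- `z` is not a pole of the Gamma function. -/
def GammaDefined (z : ℂ) : Prop := ∀ m : ℕ, z ≠ -(m : ℂ)

/-- The highest weight S-matrix amplitude a(θ). -/
def aAmp (N : ℕ) (θ : ℂ) : ℂ :=
  -(Complex.Gamma (1 - θ / twoPiI) * Complex.Gamma (1 - 1 / N + θ / twoPiI)) /
    (Complex.Gamma (1 + θ / twoPiI) * Complex.Gamma (1 - 1 / N - θ / twoPiI))

/-- The amplitude b(θ) = a(θ)·θ/(θ − iη). -/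
def bAmp (N : ℕ) (θ : ℂ) : ℂ := aAmp N θ * θ / (θ - Complex.I * etaC N)

/-- The Jost function φ(θ) = Γ(θ/(2πi))·Γ(1 − 1/N − θ/(2πi)). -/
def phiJost (N : ℕ) (θ : ℂ) : ℂ :=
  Complex.Gamma (θ / twoPiI) * Complex.Gamma (1 - 1 / N - θ / twoPiI)

/-- All Gamma factors in a(θ) are defined and the denominator Gammas are nonzero. -/
def aDefined (N : ℕ) (θ : ℂ) : Prop :=
  GammaDefined (1 - θ / twoPiI) ∧ GammaDefined (1 - 1 / N + θ / twoPiI) ∧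
    GammaDefined (1 + θ / twoPiI) ∧ GammaDefined (1 - 1 / N - θ / twoPiI) ∧
    Complex.Gamma (1 + θ / twoPiI) ≠ 0 ∧ Complex.Gamma (1 - 1 / N - θ / twoPiI) ≠ 0

/-- The amplitude b(θ) is defined: a(θ) is defined and θ − iη ≠ 0. -/
def bDefined (N : ℕ) (θ : ℂ) : Prop := aDefined N θ ∧ θ ≠ Complex.I * etaC N

/-- No Gamma argument of φ(θ) is a pole. -/
def phiDefined (N : ℕ) (θ : ℂ) : Prop :=
  GammaDefined (θ / twoPiI) ∧ GammaDefined (1 - 1 / N - θ / twoPiI)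

lemma GammaDefined.gamma_ne_zero {z : ℂ} (h : GammaDefined z) : Complex.Gamma z ≠ 0 :=
  Complex.Gamma_ne_zero h

lemma GammaDefined.ne_zero {z : ℂ} (h : GammaDefined z) : z ≠ 0 := by
  simpa using h 0

lemma twoPiI_ne_zero : twoPiI ≠ 0 := Complex.two_pi_I_ne_zero

/-- The crossing relation of the Jost function under `θ ↦ -θ`. -/
lemma phiJost_eq_phiJost_neg_mul_aAmp {N : ℕ} {θ : ℂ} (hp : phiDefined N θ)
    (hn : phiDefined N (-θ)) : phiJost N θ = phiJost N (-θ) * aAmp N (-θ) := by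
  have hx := hp.1.ne_zero
  have hg := hn.1.gamma_ne_zero
  have hc := hn.2.gamma_ne_zero
  simp only [phiJost, aAmp, neg_div, sub_neg_eq_add, ← sub_eq_add_neg] at *
  have h2 : Complex.Gamma (1 - θ / twoPiI) =
      -(θ / twoPiI) * Complex.Gamma (-(θ / twoPiI)) := by
    rw [← Complex.Gamma_add_one _ (neg_ne_zero.mpr hx)]
    ring_nf
  rw [h2, add_comm 1 (θ / twoPiI), Complex.Gamma_add_one _ hx]
  generalize θ / twoPiI = x at *
  field_simp

/-- The reflection symmetry of the Jost function about `(N - 1) iη / 2`. -/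
lemma phiJost_reflection {N : ℕ} (hN : N ≠ 0) (θ : ℂ) :
    phiJost N θ = phiJost N (((N : ℂ) - 1) * (Complex.I * etaC N) - θ) := by
  have hN' : (N : ℂ) ≠ 0 := Nat.cast_ne_zero.mpr hN
  have h : (((N : ℂ) - 1) * (Complex.I * etaC N) - θ) / twoPiI = 1 - 1 / N - θ / twoPiI := by
    rw [sub_div]
    congr 1
    rw [div_eq_iff twoPiI_ne_zero, etaC, twoPiI]
    field_simp
  rw [phiJost, phiJost, h, sub_sub_cancel, mul_comm]

/-- The relation between `b` and the Jost function under `θ ↦ 2πi - θ`. -/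
lemma neg_bAmp_mul_phiJost {N : ℕ} {θ : ℂ} (hp : phiDefined N θ)
    (hb : θ ≠ Complex.I * etaC N) :
    -bAmp N θ * phiJost N θ = phiJost N (twoPiI - θ) := by
  have hT := twoPiI_ne_zero
  have hx := hp.1.ne_zero
  have hg := hp.1.gamma_ne_zero
  have hc := hp.2.gamma_ne_zero
  have hη : Complex.I * etaC N = twoPiI * (1 / N) := by
    rw [etaC, twoPiI]
    ring
  obtain ⟨x, rfl⟩ : ∃ x, θ = twoPiI * x := ⟨θ / twoPiI, (mul_div_cancel₀ _ hT).symm⟩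
  rw [hη] at hb
  have hd : x - 1 / N ≠ 0 := fun h => hb (by rw [sub_eq_zero.mp h])
  have hr : (twoPiI - twoPiI * x) / twoPiI = 1 - x := by field_simp
  simp only [bAmp, aAmp, phiJost, hη, hr, mul_div_cancel_left₀ _ hT] at *
  rw [show 1 - 1 / (N : ℂ) + x = (x - 1 / N) + 1 by ring, Complex.Gamma_add_one _ hd,
    show 1 - 1 / (N : ℂ) - (1 - x) = x - 1 / N by ring, add_comm 1 x,
    Complex.Gamma_add_one _ hx, ← mul_sub]
  generalize 1 / (N : ℂ) = c at *
  field_simp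

/-- Functional relations of the 'Jost function' φ. -/
theorem phiJost_functional_relations (N : ℕ) (hN : 2 ≤ N) (θ : ℂ)
    (hp1 : phiDefined N θ) (hp2 : phiDefined N (-θ))
    (hp3 : phiDefined N (((N : ℂ) - 1) * (Complex.I * etaC N) - θ))
    (hp4 : phiDefined N (twoPiI - θ)) (hp5 : phiDefined N (θ - twoPiI))
    (ha1 : aDefined N (-θ)) (ha2 : aDefined N (θ - twoPiI))
    (hb : bDefined N θ) :
    phiJost N θ = phiJost N (-θ) * aAmp N (-θ) ∧
    phiJost N θ = phiJost N (((N : ℂ) - 1) * (Complex.I * etaC N) - θ) ∧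
    -bAmp N θ * phiJost N θ = phiJost N (twoPiI - θ) ∧
    -bAmp N θ * phiJost N θ = aAmp N (θ - twoPiI) * phiJost N (θ - twoPiI) := by
  have h := neg_bAmp_mul_phiJost hp1 hb.2
  refine ⟨phiJost_eq_phiJost_neg_mul_aAmp hp1 hp2, phiJost_reflection (by omega) θ, h, ?_⟩
  rw [h, phiJost_eq_phiJost_neg_mul_aAmp hp4 (by rwa [neg_sub]), neg_sub, mul_comm]
end
end

section
/- Algebraic Bethe ansatz commutation relation (C–D): for all θ = (θ1,…,θn) ∈ ℂⁿ and z, w ∈ ℂ with θ_i − z ≠ iη and θ_i − w ≠ iη for all i, z − w ≠ iη, z ≠ w, and for all β, γ, γ' ∈ {2,…,N}, one has the identity in End((ℂ^N)^{⊗n}): C̃^β(θ,z) ∘ D̃^{γ'}_γ(θ,w) = (1/b̃(z−w))·Σ_{β',γ'' ∈ {2,…,N}} S̃^{γ'β}_{β'γ''}(z−w)·D̃^{γ''}_γ(θ,w) ∘ C̃^{β'}(θ,z) − (c̃(z−w)/b̃(z−w))·D̃^{β}_γ(θ,z) ∘ C̃^{γ'}(θ,w), where S̃^{δγ}_{αβ}(θ)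 := δ_{αγ}δ_{βδ}·b̃(θ) + δ_{αδ}δ_{βγ}·c̃(θ) are the matrix entries of S̃(θ). -/
open Complex Matrix

noncomputable section

/-- The amplitude b̃(θ) = θ/(θ − iη). -/
def btilde (N : ℕ) (θ : ℂ) : ℂ := θ / (θ - Complex.I * etaC N)

/-- The amplitude c̃(θ) = −iη/(θ − iη). -/
def ctilde (N : ℕ) (θ : ℂ) : ℂ := -(Complex.I * etaC N) / (θ - Complex.I * etaC N)

/-- The matrix entries S̃^{δγ}_{αβ}(θ) = δ_{αγ}δ_{βδ}·b̃(θ) + δ_{αδ}δ_{βγ}·c̃(θ). -/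
def StEntry (N : ℕ) (θ : ℂ) (δ γ α β : Fin N) : ℂ :=
  (if α = γ then 1 else 0) * (if β = δ then 1 else 0) * btilde N θ +
    (if α = δ then 1 else 0) * (if β = γ then 1 else 0) * ctilde N θ

/-- The permutation operator P on ℂ^N ⊗ ℂ^N, P(u ⊗ v) = v ⊗ u. -/
def permOp (N : ℕ) : Matrix (Fin N × Fin N) (Fin N × Fin N) ℂ :=
  fun p q => if p.1 = q.2 ∧ p.2 = q.1 then 1 else 0

/-- The SU(N) R-matrix S̃(θ) = (θ·id − iη·P)/(θ − iη). -/
def Stilde (N : ℕ) (θ : ℂ) : Matrix (Fin N × Fin N) (Fin N × Fin N) ℂ :=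
  (θ - Complex.I * etaC N)⁻¹ •
    (θ • (1 : Matrix (Fin N × Fin N) (Fin N × Fin N) ℂ) - (Complex.I * etaC N) • permOp N)

/-- S̃ acting on the i-th quantum factor and the auxiliary (last) factor of
(ℂ^N)^{⊗n} ⊗ ℂ^N. -/
def Sq (n N : ℕ) (i : Fin n) (θ : ℂ) :
    Matrix ((Fin n → Fin N) × Fin N) ((Fin n → Fin N) × Fin N) ℂ :=
  fun p q => Stilde N θ (p.1 i, p.2) (q.1 i, q.2) *
    (if ∀ j, j ≠ i → p.1 j = q.1 j then 1 else 0)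

/-- The monodromy matrix T(θ,z) = S̃_{1,0}(θ1 − z)∘⋯∘S̃_{n,0}(θn − z). -/
def monodromy (n N : ℕ) (θ : Fin n → ℂ) (z : ℂ) :
    Matrix ((Fin n → Fin N) × Fin N) ((Fin n → Fin N) × Fin N) ℂ :=
  ((List.finRange n).map fun i => Sq n N i (θ i - z)).prod

/-- The auxiliary-space component T(θ,z)^{β'}_β = (id ⊗ e_{β'}^*) ∘ T(θ,z) ∘ (id ⊗ e_β),
an operator on (ℂ^N)^{⊗n}. -/
def Tcomp (n N : ℕ) (θ : Fin n → ℂ) (z : ℂ) (β' β : Fin N) :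
    Matrix (Fin n → Fin N) (Fin n → Fin N) ℂ :=
  fun α α' => monodromy n N θ z (α, β') (α', β)

/-- C̃^β(θ,z) = T(θ,z)^β_1 (auxiliary index 1 of the paper is `0 : Fin N`). -/
def Ctilde (n N : ℕ) [NeZero N] (θ : Fin n → ℂ) (z : ℂ) (β : Fin N) :
    Matrix (Fin n → Fin N) (Fin n → Fin N) ℂ :=
  Tcomp n N θ z β 0

/-- D̃^{β'}_β(θ,z) = T(θ,z)^{β'}_β for β, β' ∈ {2,…,N}. -/
def Dtilde (n N : ℕ) (θ : Fin n → ℂ) (z : ℂ) (β' β : Fin N) :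
    Matrix (Fin n → Fin N) (Fin n → Fin N) ℂ :=
  Tcomp n N θ z β' β

open Function

/-- The Yang-Baxter exchange relation `R T₁(z) T₂(w) = T₂(w) T₁(z) R` for the rational R-matrix,
written for the entries of `A = T(z)` and `B = T(w)`, with `u = z - w` and `s = iη`. -/
def ExchangeRel {ι R : Type*} [Ring R] [Algebra ℂ R] (u s : ℂ) (A B : Matrix ι ι R) : Prop :=
  ∀ a b c d, u • (A a b * B c d) + s • (A c b * B a d) =
    u • (B c d * A a b) + s • (B c b * A a d)

theorem ExchangeRel.one {ι R : Type*} [DecidableEq ι] [Ring R] [Algebra ℂ R] (u s : ℂ) :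
    ExchangeRel u s (1 : Matrix ι ι R) 1 := by
  intro a b c d
  simp only [Matrix.one_apply]
  split_ifs <;> simp_all

theorem ExchangeRel.mul {ι R : Type*} [Fintype ι] [Ring R] [Algebra ℂ R] {u s : ℂ}
    {A₁ B₁ A₂ B₂ : Matrix ι ι R} (h₁ : ExchangeRel u s A₁ B₁) (h₂ : ExchangeRel u s A₂ B₂)
    (hAB : ∀ a b c d, Commute (A₁ a b) (B₂ c d)) (hBA : ∀ a b c d, Commute (B₁ a b) (A₂ c d)) :
    ExchangeRel u s (A₁ * A₂) (B₁ * B₂) := by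
  have hX : ∀ a b c d, (A₁ * A₂) a b * (B₁ * B₂) c d =
      ∑ e, ∑ f, (A₁ a e * B₁ c f) * (A₂ e b * B₂ f d) := by
    intro a b c d
    simp only [Matrix.mul_apply, Finset.sum_mul_sum]
    refine Finset.sum_congr rfl fun e _ => Finset.sum_congr rfl fun f _ => ?_
    exact (hBA c f e b).symm.mul_mul_mul_comm _ _
  have hY : ∀ a b c d, (B₁ * B₂) c d * (A₁ * A₂) a b =
      ∑ e, ∑ f, (B₁ c f * A₁ a e) * (B₂ f d * A₂ e b) := by
    intro a b c d
    simp only [Matrix.mul_apply, Finset.sum_mul_sum]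
    rw [Finset.sum_comm]
    refine Finset.sum_congr rfl fun e _ => Finset.sum_congr rfl fun f _ => ?_
    exact (hAB a e f d).symm.mul_mul_mul_comm _ _
  intro a b c d
  calc u • ((A₁ * A₂) a b * (B₁ * B₂) c d) + s • ((A₁ * A₂) c b * (B₁ * B₂) a d)
      = ∑ e, ∑ f, (u • (A₁ a e * B₁ c f) + s • (A₁ c e * B₁ a f)) * (A₂ e b * B₂ f d) := by
        simp only [hX, Finset.smul_sum, ← Finset.sum_add_distrib, add_mul, smul_mul_assoc]
    _ = ∑ e, ∑ f, u • ((B₁ c f * A₁ a e) * (A₂ e b * B₂ f d)) +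
          ∑ e, ∑ f, s • ((B₁ c e * A₁ a f) * (A₂ e b * B₂ f d)) := by
        simp only [h₁ a _ c _, ← Finset.sum_add_distrib, add_mul, smul_mul_assoc]
    _ = ∑ e, ∑ f, (B₁ c f * A₁ a e) * (u • (A₂ e b * B₂ f d) + s • (A₂ f b * B₂ e d)) := by
        rw [Finset.sum_comm (f := fun e f => s • ((B₁ c e * A₁ a f) * (A₂ e b * B₂ f d)))]
        simp only [← Finset.sum_add_distrib, mul_add, mul_smul_comm]
    _ = ∑ e, ∑ f, (B₁ c f * A₁ a e) * (u • (B₂ f d * A₂ e b) + s • (B₂ f b * A₂ e d)) := by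
        simp only [h₂ _ b _ d]
    _ = u • ((B₁ * B₂) c d * (A₁ * A₂) a b) + s • ((B₁ * B₂) c b * (A₁ * A₂) a d) := by
        simp only [hY, Finset.smul_sum, ← Finset.sum_add_distrib, mul_add, mul_smul_comm]

/-- The matrix unit `e_{pq}` acting on the `i`-th tensor factor. -/
def siteUnit {n N : ℕ} (i : Fin n) (p q : Fin N) : Matrix (Fin n → Fin N) (Fin n → Fin N) ℂ :=
  Matrix.of fun α α' => if α i = p ∧ α' = update α i q then 1 else 0

theorem siteUnit_mul_apply {n N : ℕ} (i j : Fin n) (p q r t : Fin N) (α α' : Fin n → Fin N) :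
    (siteUnit i p q * siteUnit j r t) α α' =
      if α i = p ∧ update α i q j = r ∧ α' = update (update α i q) j t then 1 else 0 := by
  simp only [siteUnit, Matrix.mul_apply, Matrix.of_apply]
  rw [Finset.sum_eq_single (update α i q)]
  · by_cases h : α i = p <;> simp [h]
  · intro x _ hx
    simp [hx]
  · simp

theorem siteUnit_mul_same {n N : ℕ} (i : Fin n) (p q r t : Fin N) :
    siteUnit i p q * siteUnit i r t = (if q = r then (1 : ℂ) else 0) • siteUnit i p t := by
  ext α α'
  rw [siteUnit_mul_apply]
  by_cases h : q = r <;> simp [h, siteUnit]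

theorem siteUnit_commute {n N : ℕ} {i j : Fin n} (hij : i ≠ j) (p q r t : Fin N) :
    Commute (siteUnit i p q) (siteUnit j r t) := by
  ext α α'
  rw [siteUnit_mul_apply, siteUnit_mul_apply, update_of_ne hij, update_of_ne hij.symm,
    update_comm hij]
  exact if_congr and_left_comm rfl rfl

/-- An operator on `Q ⊗ ℂ^N`, seen as a matrix over the auxiliary space with operator entries. -/
def auxBlocks (Q ι : Type*) [Fintype Q] [DecidableEq Q] [Fintype ι] [DecidableEq ι] :
    Matrix (Q × ι) (Q × ι) ℂ →* Matrix ι ι (Matrix Q Q ℂ) where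
  toFun M := Matrix.of fun a b => Matrix.of fun α α' => M (α, a) (α', b)
  map_one' := by
    ext a b α α'
    by_cases hab : a = b <;> simp [Matrix.one_apply, hab]
  map_mul' M M' := by
    ext a b α α'
    simp [Matrix.mul_apply, Matrix.sum_apply, Fintype.sum_prod_type_right]

theorem auxBlocks_apply {Q ι : Type*} [Fintype Q] [DecidableEq Q] [Fintype ι] [DecidableEq ι]
    (M : Matrix (Q × ι) (Q × ι) ℂ) (a b : ι) (α α' : Q) :
    auxBlocks Q ι M a b α α' = M (α, a) (α', b) :=
  rfl

theorem auxBlocks_Sq {n N : ℕ} (i : Fin n) (x : ℂ) (a b : Fin N) :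
    auxBlocks _ _ (Sq n N i x) a b = (x - Complex.I * etaC N)⁻¹ •
      ((x * if a = b then 1 else 0) • 1 - (Complex.I * etaC N) • siteUnit i b a) := by
  ext α α'
  have hupd : α' = update α i a ↔ a = α' i ∧ ∀ j, j ≠ i → α j = α' j := by
    rw [eq_update_iff]
    exact and_congr eq_comm (forall₂_congr fun _ _ => eq_comm)
  have hone : α = α' ↔ α i = α' i ∧ ∀ j, j ≠ i → α j = α' j := by
    refine ⟨by rintro rfl; simp, fun h => funext fun j => ?_⟩
    by_cases hj : j = i
    · exact hj ▸ h.1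
    · exact h.2 j hj
  simp only [auxBlocks_apply, Sq, Stilde, permOp, siteUnit,
    Matrix.smul_apply, Matrix.sub_apply, Matrix.one_apply, Matrix.of_apply, Prod.mk.injEq,
    hupd, hone]
  by_cases h : ∀ j, j ≠ i → α j = α' j
  · simp only [eq_true h, and_true, if_true]
    by_cases hab : a = b <;> simp [hab]
  · simp only [eq_false h, and_false, if_false]
    simp

theorem auxBlocks_Sq_commute {n N : ℕ} {i j : Fin n} (hij : i ≠ j) (x y : ℂ) (a b c d : Fin N) :
    Commute (auxBlocks _ _ (Sq n N i x) a b) (auxBlocks _ _ (Sq n N j y) c d) := by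
  rw [auxBlocks_Sq, auxBlocks_Sq]
  refine Commute.smul_left (Commute.smul_right ?_ _) _
  refine Commute.sub_left ((Commute.one_left _).smul_left _)
    (Commute.sub_right ((Commute.one_right _).smul_right _) ?_)
  exact ((siteUnit_commute hij _ _ _ _).smul_right _).smul_left _

theorem auxBlocks_Sq_commute_prod {n N : ℕ} {i : Fin n} (l : List (Fin n)) (hi : i ∉ l) (x : ℂ)
    (y : Fin n → ℂ) (a b c d : Fin N) :
    Commute (auxBlocks _ _ (Sq n N i x) a b)
      (auxBlocks _ _ (l.map fun j => Sq n N j (y j)).prod c d) := by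
  induction l generalizing c d with
  | nil =>
    rw [List.map_nil, List.prod_nil, map_one, Matrix.one_apply]
    split_ifs
    · exact Commute.one_right _
    · exact Commute.zero_right _
  | cons j l ih =>
    rw [List.mem_cons, not_or] at hi
    rw [List.map_cons, List.prod_cons, map_mul, Matrix.mul_apply]
    exact Commute.sum_right _ _ _ fun e _ =>
      (auxBlocks_Sq_commute hi.1 _ _ _ _ _ _).mul_right (ih hi.2 _ _)

theorem exchangeRel_auxBlocks_Sq {n N : ℕ} (i : Fin n) (x z w : ℂ) :
    ExchangeRel (z - w) (Complex.I * etaC N) (auxBlocks _ _ (Sq n N i (x - z)))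
      (auxBlocks _ _ (Sq n N i (x - w))) := by
  intro a b c d
  simp only [auxBlocks_Sq, smul_mul_assoc, mul_smul_comm, sub_mul, mul_sub, one_mul, mul_one,
    siteUnit_mul_same, smul_smul]
  generalize Complex.I * etaC N = s
  module

theorem exchangeRel_auxBlocks_prod {n N : ℕ} (l : List (Fin n)) (hl : l.Nodup) (θ : Fin n → ℂ)
    (z w : ℂ) :
    ExchangeRel (z - w) (Complex.I * etaC N)
      (auxBlocks _ _ (l.map fun i => Sq n N i (θ i - z)).prod)
      (auxBlocks _ _ (l.map fun i => Sq n N i (θ i - w)).prod) := by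
  induction l with
  | nil => simpa using ExchangeRel.one _ _
  | cons i l ih =>
    rw [List.nodup_cons] at hl
    simp only [List.map_cons, List.prod_cons, map_mul]
    exact (exchangeRel_auxBlocks_Sq i _ z w).mul (ih hl.2)
      (auxBlocks_Sq_commute_prod l hl.1 _ fun i => θ i - w)
      (auxBlocks_Sq_commute_prod l hl.1 _ fun i => θ i - z)

theorem Tcomp_exchange (n N : ℕ) (θ : Fin n → ℂ) (z w : ℂ) (a b c d : Fin N) :
    (z - w) • (Tcomp n N θ z a b * Tcomp n N θ w c d) +
        (Complex.I * etaC N) • (Tcomp n N θ z c b * Tcomp n N θ w a d) =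
      (z - w) • (Tcomp n N θ w c d * Tcomp n N θ z a b) +
        (Complex.I * etaC N) • (Tcomp n N θ w c b * Tcomp n N θ z a d) :=
  exchangeRel_auxBlocks_prod _ (List.nodup_finRange n) θ z w a b c d

/-- Algebraic Bethe ansatz commutation relation (C–D). -/
theorem CD_commutation (n N : ℕ) [NeZero N] (hn : 1 ≤ n) (hN : 2 ≤ N)
    (θ : Fin n → ℂ) (z w : ℂ)
    (hz : ∀ i, θ i - z ≠ Complex.I * etaC N)
    (hw : ∀ i, θ i - w ≠ Complex.I * etaC N)
    (hzw : z - w ≠ Complex.I * etaC N) (hne : z ≠ w)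
    (β γ γ' : Fin N) (hβ : β ≠ 0) (hγ : γ ≠ 0) (hγ' : γ' ≠ 0) :
    Ctilde n N θ z β * Dtilde n N θ w γ' γ =
      (btilde N (z - w))⁻¹ •
          (∑ β' ∈ Finset.univ.filter (· ≠ (0 : Fin N)),
            ∑ γ'' ∈ Finset.univ.filter (· ≠ (0 : Fin N)),
              StEntry N (z - w) γ' β β' γ'' • (Dtilde n N θ w γ'' γ * Ctilde n N θ z β')) -
        (ctilde N (z - w) / btilde N (z - w)) •
          (Dtilde n N θ z β γ * Ctilde n N θ w γ') := by
  have hu : z - w ≠ 0 := sub_ne_zero.mpr hne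
  have hus : z - w - Complex.I * etaC N ≠ 0 := sub_ne_zero.mpr hzw
  have hb : btilde N (z - w) ≠ 0 := div_ne_zero hu hus
  have hcb : ctilde N (z - w) / btilde N (z - w) = -(Complex.I * etaC N) / (z - w) := by
    rw [ctilde, btilde, div_div_div_cancel_right₀ hus]
  have hsum : (∑ β' ∈ Finset.univ.filter (· ≠ (0 : Fin N)),
      ∑ γ'' ∈ Finset.univ.filter (· ≠ (0 : Fin N)),
        StEntry N (z - w) γ' β β' γ'' • (Dtilde n N θ w γ'' γ * Ctilde n N θ z β')) =
      btilde N (z - w) • (Dtilde n N θ w γ' γ * Ctilde n N θ z β) +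
        ctilde N (z - w) • (Dtilde n N θ w β γ * Ctilde n N θ z γ') := by
    simp [StEntry, add_smul, Finset.sum_add_distrib, ite_smul, hβ, hγ']
  rw [hsum, smul_add, smul_smul, smul_smul, inv_mul_cancel₀ hb, one_smul, inv_mul_eq_div, hcb]
  have key := Tcomp_exchange n N θ w z γ' γ β 0
  simp only [Ctilde, Dtilde]
  refine smul_right_injective _ hu ?_
  simp only [smul_add, smul_sub, smul_smul, mul_div_cancel₀ _ hu]
  linear_combination (norm := module) key
end
end
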